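/- arXiv:2409.12368 — 4 statements merged into one kernel-verified Lean document; each statement's English description precedes it below -/
import Mathlib

section
/- Let (Ω, F, P) be a probability space, e : Ω → ℝⁿ a centered square-integrable random vector with covariance P₀ = E[e eᵀ], and v : ℝᵈ × Ω → ℝᵐ a jointly measurable, centered, wide-sense stationary random field with covariance function R that is bounded, satisfying E[v(i)eᵀ] = 0 for all i. Let γ : ℝᵈ → ℝ^{m×n} be absolutely integrable and essentially bounded, let κ : ℝᵈ → ℝ^{n×m} be absolutely integrable, assume joint measurability of (i,θ) ↦ κ(i)(γ(i)e(θ) + v(i,θ)), and set s(i,θ) := γ(i)e(θ) + v(i,θ). Then for every i′ ∈ ℝᵈ, E[(e − ∫_{ℝᵈ} κ(i)s(i) di) s(i′)ᵀ] = P₀γ(i′)ᵀ − ∫_{ℝᵈ} κ(i)(γ(i)P₀γ(i′)ᵀ + R(i − i′)) di. -/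
open MeasureTheory Matrix

attribute [local instance] Matrix.frobeniusNormedAddCommGroup
  Matrix.frobeniusNormedSpace Matrix.frobeniusIsBoundedSMul

theorem aux_entries {α V ι κ : Type*} [MeasurableSpace α] {μ : Measure α} [Fintype ι] [Fintype κ]
    [NormedAddCommGroup V] [NormedSpace ℝ V] (φ : V ≃ₗ[ℝ] (ι → κ → ℝ)) (f : α → V) :
    (Integrable f μ → ∀ a b, Integrable (fun x => φ (f x) a b) μ) ∧
    ((∀ a b, Integrable (fun x => φ (f x) a b) μ) →
      ∀ a b, φ (∫ x, f x ∂μ) a b = ∫ x, φ (f x) a b ∂μ) := by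
  have : FiniteDimensional ℝ V := φ.symm.finiteDimensional
  constructor
  · intro hf a b
    exact ((φ.toContinuousLinearEquiv.integrable_comp_iff).2 hf).eval a |>.eval b
  · intro h a b
    have h1 : ∀ a, Integrable (fun x => φ (f x) a) μ := fun a => Integrable.of_eval (h a)
    have h2 : Integrable (fun x => φ (f x)) μ := Integrable.of_eval h1
    have := φ.toContinuousLinearEquiv.integral_comp_comm (μ := μ) f
    have h3 : φ (∫ x, f x ∂μ) = ∫ x, φ (f x) ∂μ := this.symm
    rw [h3, eval_integral h1, eval_integral (h a)]

theorem aux_entry_le {n m : ℕ} (A : Matrix (Fin m) (Fin n) ℝ) (a : Fin m) (b : Fin n) :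
    |A a b| ≤ ‖A‖ := by
  rw [Matrix.frobenius_norm_def, ← Real.sqrt_eq_rpow]
  apply Real.abs_le_sqrt
  have h1 : A a b ^ 2 = ‖A a b‖ ^ (2:ℝ) := by simp
  rw [h1]
  refine le_trans ?_ (Finset.single_le_sum (f := fun i => ∑ j, ‖A i j‖ ^ (2:ℝ))
    (fun i _ => by positivity) (Finset.mem_univ a))
  exact Finset.single_le_sum (f := fun j => ‖A a j‖ ^ (2:ℝ))
    (fun i _ => by positivity) (Finset.mem_univ b)

/-- Expansion of the cross-covariance of the corrected error with the innovation:
for `s i θ = γ i *ᵥ e θ + v i θ`, with `e` a centered square-integrable random vector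
of covariance `P₀`, `v` a centered w.s.s. random field with bounded covariance `R`
uncorrelated with `e`, `γ` absolutely integrable and essentially bounded, and `κ`
absolutely integrable, we have for every `i'`
`E[(e − ∫ κ(i)s(i) di) s(i')ᵀ] = P₀ γ(i')ᵀ − ∫ κ(i)(γ(i)P₀γ(i')ᵀ + R(i−i')) di`
(expectations of matrices taken entrywise, here as a Bochner integral of matrices). -/
theorem error_innovation_cross_covariance
    {d n m : ℕ}
    {Ω : Type*} [MeasurableSpace Ω] (P : Measure Ω) [IsProbabilityMeasure P]
    (e : Ω → (Fin n → ℝ))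
    (he : MemLp e 2 P)
    (he_mean : ∫ θ, e θ ∂P = 0)
    (P₀ : Matrix (Fin n) (Fin n) ℝ)
    (he_cov : ∀ a b : Fin n, ∫ θ, e θ a * e θ b ∂P = P₀ a b)
    (v : (Fin d → ℝ) → Ω → (Fin m → ℝ))
    (hv_meas : Measurable (Function.uncurry v))
    (hv_L2 : ∀ i, MemLp (v i) 2 P)
    (hv_mean : ∀ i, ∫ θ, v i θ ∂P = 0)
    (R : (Fin d → ℝ) → Matrix (Fin m) (Fin m) ℝ)
    (hv_cov : ∀ i₁ i₂ : Fin d → ℝ, ∀ a b : Fin m,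
      ∫ θ, v i₁ θ a * v i₂ θ b ∂P = R (i₁ - i₂) a b)
    (hR_bdd : ∃ C : ℝ, ∀ i, ‖R i‖ ≤ C)
    (hve : ∀ i : Fin d → ℝ, ∀ a b, ∫ θ, v i θ a * e θ b ∂P = 0)
    (γ : (Fin d → ℝ) → Matrix (Fin m) (Fin n) ℝ)
    (hγ_int : @Integrable (Matrix (Fin m) (Fin n) ℝ)
      PseudoMetricSpace.toUniformSpace.toTopologicalSpace
      SeminormedAddGroup.toContinuousENorm (Fin d → ℝ) _ γ volume)
    (hγ_bdd : ∃ C : ℝ, ∀ᵐ i : Fin d → ℝ, ‖γ i‖ ≤ C)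
    (κ : (Fin d → ℝ) → Matrix (Fin n) (Fin m) ℝ)
    (hκ : @Integrable (Matrix (Fin n) (Fin m) ℝ)
      PseudoMetricSpace.toUniformSpace.toTopologicalSpace
      SeminormedAddGroup.toContinuousENorm (Fin d → ℝ) _ κ volume)
    (s : (Fin d → ℝ) → Ω → (Fin m → ℝ))
    (hs : ∀ i θ, s i θ = (γ i) *ᵥ e θ + v i θ)
    (hmeas : Measurable fun p : (Fin d → ℝ) × Ω => (κ p.1) *ᵥ s p.1 p.2) :
    ∀ i' : Fin d → ℝ,
      (∫ θ, vecMulVec (e θ - ∫ i : Fin d → ℝ, (κ i) *ᵥ s i θ) (s i' θ) ∂P)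
        = P₀ * (γ i')ᵀ
          - ∫ i : Fin d → ℝ, κ i * (γ i * P₀ * (γ i')ᵀ + R (i - i')) := by
  intro i'
  obtain ⟨Cγ, hCγ⟩ := hγ_bdd
  have heL : ∀ a, MemLp (fun θ => e θ a) 2 P := fun a => he.eval a
  have hvL : ∀ i a, MemLp (fun θ => v i θ a) 2 P := fun i a => (hv_L2 i).eval a
  have hs' : ∀ i θ b, s i θ b = (∑ k, γ i b k * e θ k) + v i θ b := by
    intro i θ b; rw [hs]; simp [Matrix.mulVec, dotProduct]
  have hγe : ∀ i b, MemLp (fun θ => ∑ k, γ i b k * e θ k) 2 P := fun i b =>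
    memLp_finsetSum _ fun k _ => (heL k).const_mul _
  have hsL : ∀ i b, MemLp (fun θ => s i θ b) 2 P := by
    intro i b
    simp_rw [hs']
    exact (hγe i b).add (hvL i b)
  -- cross moments
  have hes : ∀ i a c, ∫ θ, e θ a * s i θ c ∂P = (P₀ * (γ i)ᵀ) a c := by
    intro i a c
    have h1 : ∀ θ, e θ a * s i θ c = (∑ k, γ i c k * (e θ a * e θ k)) + v i θ c * e θ a := by
      intro θ; rw [hs', mul_add, Finset.mul_sum]
      congr 1
      · exact Finset.sum_congr rfl fun k _ => by ring
      · ring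
    have hi : ∀ k ∈ Finset.univ, Integrable (fun θ => γ i c k * (e θ a * e θ k)) P :=
      fun k _ => ((heL a).integrable_mul (heL k)).const_mul _
    simp_rw [h1]
    have hj : Integrable (fun θ => v i θ c * e θ a) P := (hvL i c).integrable_mul (heL a)
    rw [integral_add (integrable_finsetSum _ hi) hj,
      hve, integral_finsetSum _ hi]
    simp_rw [integral_const_mul, he_cov]
    simp [Matrix.mul_apply, mul_comm]
  have hvs : ∀ i j b c, ∫ θ, v i θ b * s j θ c ∂P = R (i - j) b c := by
    intro i j b c
    have h1 : ∀ θ, v i θ b * s j θ c = (∑ k, γ j c k * (v i θ b * e θ k)) + v i θ b * v j θ c := by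
      intro θ; rw [hs', mul_add, Finset.mul_sum]
      congr 1
      exact Finset.sum_congr rfl fun k _ => by ring
    have hi : ∀ k ∈ Finset.univ, Integrable (fun θ => γ j c k * (v i θ b * e θ k)) P :=
      fun k _ => ((hvL i b).integrable_mul (heL k)).const_mul _
    simp_rw [h1]
    have hj : Integrable (fun θ => v i θ b * v j θ c) P := (hvL i b).integrable_mul (hvL j c)
    rw [integral_add (integrable_finsetSum _ hi) hj,
      hv_cov, integral_finsetSum _ hi]
    simp_rw [integral_const_mul, hve]
    simp
  have hss : ∀ i j b c, ∫ θ, s i θ b * s j θ c ∂P = (γ i * P₀ * (γ j)ᵀ + R (i - j)) b c := by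
    intro i j b c
    have h1 : ∀ θ, s i θ b * s j θ c = (∑ k, γ i b k * (e θ k * s j θ c)) + v i θ b * s j θ c := by
      intro θ; rw [hs' i, add_mul, Finset.sum_mul]
      congr 1
      exact Finset.sum_congr rfl fun k _ => by ring
    have hi : ∀ k ∈ Finset.univ, Integrable (fun θ => γ i b k * (e θ k * s j θ c)) P :=
      fun k _ => ((heL k).integrable_mul (hsL j c)).const_mul _
    simp_rw [h1]
    have hj : Integrable (fun θ => v i θ b * s j θ c) P := (hvL i b).integrable_mul (hsL j c)
    rw [integral_add (integrable_finsetSum _ hi) hj,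
      hvs, integral_finsetSum _ hi]
    simp_rw [integral_const_mul, hes]
    rw [Matrix.add_apply, Matrix.mul_assoc, Matrix.mul_apply]
  -- second moment bound
  have hbd : ∃ C : ℝ, ∀ᵐ i : Fin d → ℝ, ∀ b, ∫ θ, s i θ b * s i θ b ∂P ≤ C := by
    refine ⟨Cγ * ‖P₀‖ * Cγ + ‖R 0‖, ?_⟩
    filter_upwards [hCγ] with i hi b
    rw [hss, sub_self]
    refine (le_abs_self _).trans ((aux_entry_le _ _ _).trans ((norm_add_le _ _).trans ?_))
    gcongr
    refine (Matrix.frobenius_norm_mul _ _).trans ?_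
    rw [Matrix.frobenius_norm_transpose]
    have h0 := (norm_nonneg _).trans hi
    have := (Matrix.frobenius_norm_mul (γ i) P₀)
    have : ‖γ i * P₀‖ ≤ Cγ * ‖P₀‖ := this.trans (by gcongr)
    gcongr
  obtain ⟨C, hC⟩ := hbd
  -- integrability on the product
  have hκe : ∀ a b, Integrable (fun i => κ i a b) :=
    (aux_entries (LinearEquiv.refl ℝ (Matrix (Fin n) (Fin m) ℝ)) κ).1 hκ
  have key : ∀ (a : Fin n) (g : Ω → ℝ), MemLp g 2 P →
      Integrable (fun p : (Fin d → ℝ) × Ω => (κ p.1 *ᵥ s p.1 p.2) a * g p.2)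
        (volume.prod P) := by
    intro a g hg
    have hm : AEStronglyMeasurable
        (fun p : (Fin d → ℝ) × Ω => (κ p.1 *ᵥ s p.1 p.2) a * g p.2) (volume.prod P) :=
      ((measurable_pi_iff.1 hmeas a).aestronglyMeasurable).mul hg.1.comp_snd
    have hsec : ∀ i, ∀ b, Integrable (fun θ => s i θ b * g θ) P :=
      fun i b => (hsL i b).integrable_mul hg
    have hexp : ∀ i θ, (κ i *ᵥ s i θ) a * g θ = ∑ b, κ i a b * (s i θ b * g θ) := by
      intro i θ
      simp only [Matrix.mulVec, dotProduct, Finset.sum_mul, mul_assoc]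
    rw [integrable_prod_iff hm]
    constructor
    · refine Filter.Eventually.of_forall fun i => ?_
      simp only [hexp]
      exact integrable_finsetSum _ fun b _ => (hsec i b).const_mul _
    · refine Integrable.mono' (g := fun i => ∑ b, |κ i a b| * (C + ∫ θ, g θ * g θ ∂P)) ?_
        hm.norm.integral_prod_right' ?_
      · exact integrable_finsetSum _ fun b _ => (hκe a b).abs.mul_const _
      · filter_upwards [hC] with i hi
        rw [Real.norm_of_nonneg (integral_nonneg fun _ => norm_nonneg _)]
        have hint : ∀ b ∈ Finset.univ, Integrable (fun θ => |κ i a b| * |s i θ b * g θ|) P :=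
          fun b _ => (hsec i b).abs.const_mul _
        have h1 : ∫ θ, ‖(κ i *ᵥ s i θ) a * g θ‖ ∂P ≤ ∫ θ, ∑ b, |κ i a b| * |s i θ b * g θ| ∂P := by
          apply integral_mono_of_nonneg (Filter.Eventually.of_forall fun _ => norm_nonneg _)
            (integrable_finsetSum _ hint)
          refine Filter.Eventually.of_forall fun θ => ?_
          simp only [hexp]
          refine (norm_sum_le _ _).trans (Finset.sum_le_sum fun b _ => ?_)
          rw [Real.norm_eq_abs, abs_mul]
        refine h1.trans ?_
        rw [integral_finsetSum _ hint]
        refine Finset.sum_le_sum fun b _ => ?_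
        rw [integral_const_mul]
        refine mul_le_mul_of_nonneg_left ?_ (abs_nonneg _)
        have hi1 : Integrable (fun θ => s i θ b * s i θ b) P := (hsL i b).integrable_mul (hsL i b)
        have hi2 : Integrable (fun θ => g θ * g θ) P := hg.integrable_mul hg
        have h2 : ∫ θ, |s i θ b * g θ| ∂P ≤ ∫ θ, (s i θ b * s i θ b + g θ * g θ) ∂P := by
          apply integral_mono (hsec i b).abs (hi1.add hi2)
          intro θ
          change |s i θ b * g θ| ≤ s i θ b * s i θ b + g θ * g θ
          rw [abs_le]
          constructor <;>
          nlinarith [sq_nonneg (s i θ b + g θ), sq_nonneg (s i θ b - g θ),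
            sq_nonneg (s i θ b), sq_nonneg (g θ)]
        rw [integral_add hi1 hi2] at h2
        linarith [hi b]
  -- inner vector integral
  have hF : ∀ᵐ θ ∂P, ∀ a, (∫ i : Fin d → ℝ, κ i *ᵥ s i θ) a = ∫ i, (κ i *ᵥ s i θ) a := by
    have h1 : ∀ᵐ θ ∂P, ∀ a, Integrable (fun i => (κ i *ᵥ s i θ) a) := by
      rw [ae_all_iff]
      intro a
      have := (key a (fun _ => 1) (memLp_const 1)).prod_left_ae
      simpa using this
    filter_upwards [h1] with θ hθ a
    exact eval_integral hθ a
  have hEnt : ∀ a c, (fun θ => (vecMulVec (e θ - ∫ i : Fin d → ℝ, (κ i) *ᵥ s i θ) (s i' θ)) a c)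
      =ᵐ[P] fun θ => e θ a * s i' θ c - ∫ i, (κ i *ᵥ s i θ) a * s i' θ c := by
    intro a c
    filter_upwards [hF] with θ hθ
    rw [vecMulVec_apply, Pi.sub_apply, hθ a, sub_mul, integral_mul_const]
  have hI1 : ∀ a c, Integrable (fun θ => e θ a * s i' θ c) P :=
    fun a c => (heL a).integrable_mul (hsL i' c)
  have hI2 : ∀ a c, Integrable (fun θ => ∫ i, (κ i *ᵥ s i θ) a * s i' θ c) P :=
    fun a c => (key a _ (hsL i' c)).integral_prod_right
  have hin : ∀ i a c, ∫ θ, (κ i *ᵥ s i θ) a * s i' θ c ∂P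
      = (κ i * (γ i * P₀ * (γ i')ᵀ + R (i - i'))) a c := by
    intro i a c
    have hexp : ∀ θ, (κ i *ᵥ s i θ) a * s i' θ c = ∑ b, κ i a b * (s i θ b * s i' θ c) := by
      intro θ
      simp only [Matrix.mulVec, dotProduct, Finset.sum_mul, mul_assoc]
    simp_rw [hexp]
    have hj : ∀ b ∈ Finset.univ, Integrable (fun θ => κ i a b * (s i θ b * s i' θ c)) P :=
      fun b _ => ((hsL i b).integrable_mul (hsL i' c)).const_mul _
    rw [integral_finsetSum _ hj]
    simp_rw [integral_const_mul, hss]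
    rw [Matrix.mul_apply]
  have hI3 : ∀ a c, Integrable fun i => (κ i * (γ i * P₀ * (γ i')ᵀ + R (i - i'))) a c := by
    intro a c
    have := (key a _ (hsL i' c)).integral_prod_left
    simpa only [hin] using this
  ext a c
  have hL := (aux_entries (μ := P) (LinearEquiv.refl ℝ (Matrix (Fin n) (Fin m) ℝ))
    (fun θ => vecMulVec (e θ - ∫ i : Fin d → ℝ, (κ i) *ᵥ s i θ) (s i' θ))).2
    (fun a c => ((hI1 a c).sub (hI2 a c)).congr (hEnt a c).symm) a c
  have hR := (aux_entries (μ := volume) (LinearEquiv.refl ℝ (Matrix (Fin n) (Fin m) ℝ))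
    (fun i : Fin d → ℝ => κ i * (γ i * P₀ * (γ i')ᵀ + R (i - i')))).2 hI3 a c
  refine hL.trans ?_
  rw [Matrix.sub_apply]
  refine Eq.trans ?_ (congrArg (fun x => (P₀ * (γ i')ᵀ) a c - x) hR.symm)
  refine (integral_congr_ae (hEnt a c)).trans ?_
  rw [integral_sub (hI1 a c) (hI2 a c), hes]
  congr 1
  refine (integral_integral_swap (key a _ (hsL i' c))).symm.trans ?_
  exact integral_congr_ae (Filter.Eventually.of_forall fun i => hin i a c)
end

section
/- Let P ∈ ℝ^{n×n} be symmetric, γ ∈ L¹(ℝᵈ, ℝ^{m×n}) ∩ L∞(ℝᵈ, ℝ^{m×n}), R ∈ L¹(ℝᵈ, ℝ^{m×m}) ∩ L∞(ℝᵈ, ℝ^{m×m}), and κ ∈ L¹(ℝᵈ, ℝ^{n×m}) satisfy the optimality condition ∫_{ℝᵈ} κ(i)(γ(i)Pγ(i′)ᵀ + R(i − i′)) di = Pγ(i′)ᵀ for almost every i′ ∈ ℝᵈ. Then P − (∫_{ℝᵈ} κ(i)γ(i) di)P − P(∫_{ℝᵈ} γ(i)ᵀκ(i)ᵀ di) + (∫_{ℝᵈ}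 κ(i)γ(i) di)P(∫_{ℝᵈ} γ(i)ᵀκ(i)ᵀ di) + ∫_{ℝᵈ}∫_{ℝᵈ} κ(i)R(i − i′)κ(i′)ᵀ di di′ = (I − ∫_{ℝᵈ} κ(i)γ(i) di)P; that is, the posterior error covariance obtained from the optimal gain equals (I − ∫κγ di)P. -/
open MeasureTheory Matrix

attribute [local instance] Matrix.frobeniusNormedAddCommGroup
  Matrix.frobeniusNormedSpace Matrix.frobeniusIsBoundedSMul

attribute [-instance] instTopologicalSpaceMatrix Matrix.instUniformSpace

noncomputable def mulCLM (a b c : ℕ) : Matrix (Fin a) (Fin b) ℝ →L[ℝ] Matrix (Fin b) (Fin c) ℝ →L[ℝ]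
    Matrix (Fin a) (Fin c) ℝ :=
  LinearMap.mkContinuous₂ (LinearMap.mk₂ ℝ (fun A B => A * B)
    (fun _ _ _ => Matrix.add_mul _ _ _) (fun _ _ _ => Matrix.smul_mul _ _ _)
    (fun _ _ _ => Matrix.mul_add _ _ _) (fun _ _ _ => Matrix.mul_smul _ _ _)) 1
    (fun A B => by simpa using Matrix.frobenius_norm_mul A B)

lemma mulCLM_apply (a b c : ℕ) (A : Matrix (Fin a) (Fin b) ℝ) (B : Matrix (Fin b) (Fin c) ℝ) :
    mulCLM a b c A B = A * B := rfl

noncomputable def trCLM (a b : ℕ) : Matrix (Fin a) (Fin b) ℝ →L[ℝ] Matrix (Fin b) (Fin a) ℝ :=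
  LinearMap.mkContinuous
    { toFun := fun A => Aᵀ
      map_add' := fun _ _ => Matrix.transpose_add _ _
      map_smul' := fun _ _ => Matrix.transpose_smul _ _ } 1
    (fun A => by simpa using (Matrix.frobenius_norm_transpose A).le)

lemma trCLM_apply (a b : ℕ) (A : Matrix (Fin a) (Fin b) ℝ) : trCLM a b A = Aᵀ := rfl

lemma integrable_mul_bdd {X : Type*} [MeasurableSpace X] {μ : Measure X} {a b c : ℕ}
    {f : X → Matrix (Fin a) (Fin b) ℝ} {g : X → Matrix (Fin b) (Fin c) ℝ}
    (hf : Integrable f μ) (hg : AEStronglyMeasurable g μ) (C : ℝ)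
    (hC : ∀ᵐ x ∂μ, ‖g x‖ ≤ C) : Integrable (fun x => f x * g x) μ := by
  refine Integrable.mono' (hf.norm.mul_const C)
    ((mulCLM a b c).aestronglyMeasurable_comp₂ hf.aestronglyMeasurable hg) ?_
  filter_upwards [hC] with x hx
  exact (Matrix.frobenius_norm_mul _ _).trans (by gcongr)

lemma integral_const_mul_mat {X : Type*} [MeasurableSpace X] {μ : Measure X} {a b c : ℕ}
    (A : Matrix (Fin a) (Fin b) ℝ) {g : X → Matrix (Fin b) (Fin c) ℝ}
    (hg : Integrable g μ) : ∫ x, A * g x ∂μ = A * ∫ x, g x ∂μ :=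
  (mulCLM a b c A).integral_comp_comm hg

lemma integral_mul_const_mat {X : Type*} [MeasurableSpace X] {μ : Measure X} {a b c : ℕ}
    (B : Matrix (Fin b) (Fin c) ℝ) {g : X → Matrix (Fin a) (Fin b) ℝ}
    (hg : Integrable g μ) : ∫ x, g x * B ∂μ = (∫ x, g x ∂μ) * B :=
  ((mulCLM a b c).flip B).integral_comp_comm hg

/-- If `P` is symmetric and `κ` satisfies the optimality condition
`∫ κ(i)(γ(i)Pγ(i')ᵀ + R(i − i')) di = Pγ(i')ᵀ` for a.e. `i'`, then the expanded posterior
error covariance collapses to `(I − ∫ κγ di)P`. -/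
theorem posterior_covariance_simplification
    {d n m : ℕ}
    (P : Matrix (Fin n) (Fin n) ℝ)
    (hPsymm : P.IsSymm)
    (γ : (Fin d → ℝ) → Matrix (Fin m) (Fin n) ℝ)
    (hγ1 : Integrable γ)
    (hγbdd : ∃ C : ℝ, ∀ᵐ i : Fin d → ℝ, ‖γ i‖ ≤ C)
    (R : (Fin d → ℝ) → Matrix (Fin m) (Fin m) ℝ)
    (hR1 : Integrable R)
    (hRbdd : ∃ C : ℝ, ∀ᵐ i : Fin d → ℝ, ‖R i‖ ≤ C)
    (κ : (Fin d → ℝ) → Matrix (Fin n) (Fin m) ℝ)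
    (hκ1 : Integrable κ)
    (hopt : ∀ᵐ i' : Fin d → ℝ,
      (∫ i : Fin d → ℝ, κ i * (γ i * P * (γ i')ᵀ + R (i - i'))) = P * (γ i')ᵀ) :
    P - (∫ i : Fin d → ℝ, κ i * γ i) * P - P * (∫ i : Fin d → ℝ, (γ i)ᵀ * (κ i)ᵀ)
        + (∫ i : Fin d → ℝ, κ i * γ i) * P * (∫ i : Fin d → ℝ, (γ i)ᵀ * (κ i)ᵀ)
        + (∫ i' : Fin d → ℝ, ∫ i : Fin d → ℝ, κ i * R (i - i') * (κ i')ᵀ)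
      = (1 - ∫ i : Fin d → ℝ, κ i * γ i) * P := by
  obtain ⟨Cγ, hCγ⟩ := hγbdd
  obtain ⟨CR, hCR⟩ := hRbdd
  have hK : Integrable (fun i => κ i * γ i) :=
    integrable_mul_bdd hκ1 hγ1.aestronglyMeasurable Cγ hCγ
  have hKT : Integrable (fun i => (γ i)ᵀ * (κ i)ᵀ) := by
    have h := (trCLM n n).integrable_comp hK
    refine h.congr (Filter.Eventually.of_forall fun i => ?_)
    simp only [trCLM_apply, Matrix.transpose_mul]
  have hS : ∀ i', Integrable (fun i => κ i * R (i - i')) := fun i' =>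
    integrable_mul_bdd hκ1 (hR1.comp_sub_right i').aestronglyMeasurable CR
      ((measurePreserving_sub_right volume i').quasiMeasurePreserving.ae hCR)
  have key : ∀ᵐ i' : Fin d → ℝ, (∫ i : Fin d → ℝ, κ i * R (i - i') * (κ i')ᵀ)
      = (P - (∫ i : Fin d → ℝ, κ i * γ i) * P) * ((γ i')ᵀ * (κ i')ᵀ) := by
    filter_upwards [hopt] with i' h
    rw [integral_mul_const_mat _ (hS i')]
    have e : ∀ i, κ i * (γ i * P * (γ i')ᵀ + R (i - i'))
        = κ i * γ i * (P * (γ i')ᵀ) + κ i * R (i - i') := fun i => by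
      simp only [Matrix.mul_add, Matrix.mul_assoc]
    have hI : Integrable (fun i => κ i * γ i * (P * (γ i')ᵀ)) :=
      ((mulCLM n n m).flip (P * (γ i')ᵀ)).integrable_comp hK
    simp only [e] at h
    rw [integral_add hI (hS i'), integral_mul_const_mat _ hK] at h
    rw [eq_sub_of_add_eq' h]
    simp only [Matrix.sub_mul, Matrix.mul_assoc]
  rw [integral_congr_ae key, integral_const_mul_mat _ hKT]
  simp only [Matrix.sub_mul, Matrix.one_mul]
  abel
end

section
/- Let P, S ∈ ℝ^{n×n} be symmetric positive semi-definite matrices. Then: (i) the matrix I + SP is invertible; (ii) the matrix F := P(I + SP)^{-1} satisfies F = (I − FS)P, i.e. F is the unique solution of the equation F(I + SP) = P; and (iii) F is symmetric and positive semi-definite (in particular P(I + SP)^{-1} = (I + PS)^{-1}P). -/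
open Matrix

/-- For symmetric positive semi-definite matrices `P` and `S`:
(i) `I + SP` is invertible;
(ii) `F = P(I + SP)⁻¹` satisfies `F = (I − FS)P`, and is the unique solution of
`F(I + SP) = P`;
(iii) `F` is symmetric positive semi-definite, and `P(I + SP)⁻¹ = (I + PS)⁻¹P`. -/
theorem psd_resolvent_properties
    {n : ℕ}
    (P S : Matrix (Fin n) (Fin n) ℝ)
    (hP : P.PosSemidef)
    (hS : S.PosSemidef) :
    IsUnit (1 + S * P) ∧
      (P * (1 + S * P)⁻¹ = (1 - P * (1 + S * P)⁻¹ * S) * P) ∧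
      (P * (1 + S * P)⁻¹ * (1 + S * P) = P ∧
        ∀ F : Matrix (Fin n) (Fin n) ℝ, F * (1 + S * P) = P → F = P * (1 + S * P)⁻¹) ∧
      (P * (1 + S * P)⁻¹).PosSemidef ∧
      P * (1 + S * P)⁻¹ = (1 + P * S)⁻¹ * P := by
  have hPt : Pᴴ = P := hP.isHermitian
  have hSt : Sᴴ = S := hS.isHermitian
  have hU : IsUnit (1 + S * P) := by
    rw [← Matrix.mulVec_injective_iff_isUnit]
    rw [← Matrix.coe_mulVecLin, injective_iff_map_eq_zero]
    intro v hv
    rw [Matrix.mulVecLin_apply, Matrix.add_mulVec, Matrix.one_mulVec, ← Matrix.mulVec_mulVec] at hv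
    have h1 := hP.dotProduct_mulVec_nonneg v
    have h2 := hS.dotProduct_mulVec_nonneg (P *ᵥ v)
    have h3 : (P *ᵥ v) ⬝ᵥ (v + S *ᵥ (P *ᵥ v)) = 0 := by rw [hv]; simp
    rw [dotProduct_add, dotProduct_comm] at h3
    simp only [star_trivial] at h1 h2
    have h4 : star v ⬝ᵥ (P *ᵥ v) = 0 := by
      simp only [star_trivial]
      linarith
    have h5 := (hP.dotProduct_mulVec_zero_iff v).1 h4
    simpa [h5] using hv
  have hd : IsUnit (1 + S * P).det := (Matrix.isUnit_iff_isUnit_det _).1 hU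
  have hT : (1 + S * P)ᴴ = 1 + P * S := by
    rw [Matrix.conjTranspose_add, Matrix.conjTranspose_mul, hPt, hSt, Matrix.conjTranspose_one]
  have hd2 : IsUnit (1 + P * S).det := by
    rw [← hT]
    exact (Matrix.isUnit_iff_isUnit_det _).1 hU.star
  have hF : P * (1 + S * P)⁻¹ * (1 + S * P) = P := Matrix.nonsing_inv_mul_cancel_right _ _ hd
  have huniq : ∀ F : Matrix (Fin n) (Fin n) ℝ, F * (1 + S * P) = P → F = P * (1 + S * P)⁻¹ := by
    intro F h
    have h2 := Matrix.mul_nonsing_inv_cancel_right _ F hd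
    rw [h] at h2
    exact h2.symm
  have hcomm : P * (1 + S * P)⁻¹ = (1 + P * S)⁻¹ * P := by
    symm
    apply huniq
    have : P * (1 + S * P) = (1 + P * S) * P := by noncomm_ring
    rw [Matrix.mul_assoc, this, Matrix.nonsing_inv_mul_cancel_left _ _ hd2]
  refine ⟨hU, ?_, ⟨hF, huniq⟩, ?_, hcomm⟩
  · generalize P * (1 + S * P)⁻¹ = F at hF
    rw [sub_mul, one_mul, eq_sub_iff_add_eq, Matrix.mul_assoc]
    rw [mul_add, mul_one] at hF
    exact hF
  · have h := (hP.add (hS.conjTranspose_mul_mul_same P)).conjTranspose_mul_mul_same (1 + S * P)⁻¹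
    have e : P + Pᴴ * S * P = (1 + P * S) * P := by rw [hPt]; noncomm_ring
    rw [e, Matrix.conjTranspose_nonsing_inv, hT, Matrix.nonsing_inv_mul_cancel_left _ _ hd2] at h
    exact h
end

section
/- Let A ∈ ℝ^{n×n}, let Q ∈ ℝ^{n×n} be symmetric positive definite, and let G ∈ ℝ^{n×n} be symmetric positive semi-definite. Assume the pair (A, Q) is stabilizable (there exists C ∈ ℝ^{n×n} with spectral radius ρ(A + QCᵀ) < 1) and the pair (A, G) is detectable (i.e. (Aᵀ, G) is stabilizable). Then for every symmetric positive semi-definite initial matrix P₀, the sequence defined by the discrete-time Riccati recursion P_{k+1} = A P_k Aᵀ − A P_k G (I + Gᵀ P_k G)^{-1} Gᵀ P_k Aᵀ + Q converges as k → ∞ to a limit P∞ that does not depend on P₀, and P∞ is the unique symmetric positive semi-definite solution of the discrete-time algebraic Riccati equation P∞ = A P∞ Aᵀ − A P∞ G (I + Gᵀ P∞ G)^{-1} Gᵀ P∞ Aᵀ + Q. -/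
open Matrix Filter

/-- The spectral radius of a real square matrix: the supremum of the moduli of its complex
eigenvalues (elements of the spectrum of the matrix viewed over `ℂ`). -/
noncomputable def specRad {n : ℕ} (M : Matrix (Fin n) (Fin n) ℝ) : ℝ :=
  sSup {r : ℝ | ∃ μ ∈ spectrum ℂ (M.map (Complex.ofReal ·)), r = ‖μ‖}

/-- The pair `(A, B)` is stabilizable if some `C` makes `ρ(A + BCᵀ) < 1`. -/
def Stabilizable {n : ℕ} (A B : Matrix (Fin n) (Fin n) ℝ) : Prop :=
  ∃ C : Matrix (Fin n) (Fin n) ℝ, specRad (A + B * Cᵀ) < 1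

/-- The pair `(A, B)` is detectable if `(Aᵀ, B)` is stabilizable. -/
def Detectable {n : ℕ} (A B : Matrix (Fin n) (Fin n) ℝ) : Prop :=
  Stabilizable Aᵀ B


open scoped MatrixOrder

theorem ric_pow_tendsto {n : ℕ} (M : Matrix (Fin n) (Fin n) ℝ) (h : specRad M < 1) :
    Tendsto (fun k => M ^ k) atTop (nhds 0) := by
  rcases Nat.eq_zero_or_pos n with rfl | hn
  · have : ∀ X Y : Matrix (Fin 0) (Fin 0) ℝ, X = Y := fun X Y => Subsingleton.elim _ _
    rw [show (fun k => M ^ k) = fun _ => 0 from funext fun k => this _ _]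
    exact tendsto_const_nhds
  haveI : Nonempty (Fin n) := ⟨⟨0, hn⟩⟩
  letI : NormedRing (Matrix (Fin n) (Fin n) ℂ) := Matrix.linftyOpNormedRing
  letI : NormedAlgebra ℂ (Matrix (Fin n) (Fin n) ℂ) := Matrix.linftyOpNormedAlgebra
  haveI : CompleteSpace (Matrix (Fin n) (Fin n) ℂ) := FiniteDimensional.complete ℂ _
  set N : Matrix (Fin n) (Fin n) ℂ := M.map (Complex.ofReal ·) with hN
  have hsr : spectralRadius ℂ N < 1 := by
    have := spectrum.spectralRadius_lt_of_forall_lt N (r := 1) ?_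
    · simpa using this
    intro μ hμ
    have hb : BddAbove {r : ℝ | ∃ μ ∈ spectrum ℂ N, r = ‖μ‖} := by
      refine ⟨‖N‖ * ‖(1 : Matrix (Fin n) (Fin n) ℂ)‖, ?_⟩
      rintro r ⟨ν, hν, rfl⟩
      exact spectrum.norm_le_norm_mul_of_mem hν
    have h1 : ‖μ‖ ≤ specRad M := le_csSup hb ⟨μ, hμ, rfl⟩
    rw [← NNReal.coe_lt_coe]
    simpa using lt_of_le_of_lt h1 h
  obtain ⟨r, hr1, hr2⟩ := exists_between hsr
  have hrt : r ≠ ⊤ := (hr2.trans ENNReal.one_lt_top).ne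
  lift r to NNReal using hrt
  have hr2' : (r : ℝ) < 1 := by exact_mod_cast hr2
  have hg := (spectrum.pow_nnnorm_pow_one_div_tendsto_nhds_spectralRadius N).eventually
    (gt_mem_nhds hr1)
  have hle : ∀ᶠ k : ℕ in atTop, ‖N ^ k‖ ≤ (r : ℝ) ^ k := by
    filter_upwards [hg, eventually_gt_atTop 0] with k hk hk0
    have h2 : (‖N ^ k‖₊ : ENNReal) ≤ (r : ENNReal) ^ k := by
      have := ENNReal.rpow_le_rpow hk.le (z := (k : ℝ)) (by positivity)
      rw [← ENNReal.rpow_mul, one_div, inv_mul_cancel₀ (by positivity), ENNReal.rpow_one,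
        ENNReal.rpow_natCast] at this
      exact this
    exact_mod_cast h2
  have hz : Tendsto (fun k => N ^ k) atTop (nhds 0) := by
    refine squeeze_zero_norm' hle ?_
    exact tendsto_pow_atTop_nhds_zero_of_lt_one r.2 hr2'
  have hre : Continuous (fun X : Matrix (Fin n) (Fin n) ℂ => X.map Complex.re) :=
    Continuous.matrix_map continuous_id Complex.continuous_re
  have h3 := (hre.tendsto 0).comp hz
  have h4 : ∀ k, N ^ k = (M ^ k).map (Complex.ofReal ·) := by
    intro k
    exact (Matrix.map_pow M Complex.ofRealHom k).symm
  have h5 : ((fun X : Matrix (Fin n) (Fin n) ℂ => X.map Complex.re) ∘ fun k => N ^ k)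
      = fun k => M ^ k := by
    funext k
    simp only [Function.comp, h4]
    ext i j
    simp
  rw [h5] at h3
  simpa using h3

theorem ric_le_sum {n : ℕ} (V : Matrix (Fin n) (Fin n) ℝ) (hV : V.IsHermitian) (c : ℝ)
    (hc : ∑ i, ∑ j, |V i j| ≤ c) : V ≤ c • 1 := by
  rw [Matrix.le_iff]
  refine PosSemidef.of_dotProduct_mulVec_nonneg ?_ ?_
  · exact ((isHermitian_one).smul (by simp [IsSelfAdjoint])).sub hV
  · intro x
    rw [sub_mulVec, dotProduct_sub, smul_mulVec, one_mulVec, dotProduct_smul, sub_nonneg]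
    have hx0 : 0 ≤ x ⬝ᵥ x := by
      simp only [dotProduct]; exact Finset.sum_nonneg fun i _ => mul_self_nonneg _
    have hxi : ∀ i, x i * x i ≤ x ⬝ᵥ x := fun i => by
      simp only [dotProduct]
      exact Finset.single_le_sum (f := fun i => x i * x i) (fun i _ => mul_self_nonneg _)
        (Finset.mem_univ i)
    calc star x ⬝ᵥ V *ᵥ x = ∑ i, ∑ j, x i * (V i j * x j) := by
          simp [dotProduct, mulVec, Finset.mul_sum]
      _ ≤ ∑ i, ∑ j, |V i j| * (x ⬝ᵥ x) := by
          refine Finset.sum_le_sum fun i _ => Finset.sum_le_sum fun j _ => ?_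
          have h1 : x i * (V i j * x j) ≤ |V i j| * |x i * x j| := by
            rw [← abs_mul]; refine le_trans (le_of_eq ?_) (le_abs_self _); ring
          refine h1.trans (mul_le_mul_of_nonneg_left ?_ (abs_nonneg _))
          rw [abs_le]
          constructor <;> nlinarith [hxi i, hxi j, sq_nonneg (x i + x j), sq_nonneg (x i - x j)]
      _ = (∑ i, ∑ j, |V i j|) * (x ⬝ᵥ x) := by simp only [Finset.sum_mul]
      _ ≤ c * (x ⬝ᵥ x) := mul_le_mul_of_nonneg_right hc hx0
      _ = c • (star x ⬝ᵥ x) := by simp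

theorem ric_conj_mono {n : ℕ} {X Y : Matrix (Fin n) (Fin n) ℝ} (h : X ≤ Y)
    (B : Matrix (Fin n) (Fin n) ℝ) : B * X * Bᵀ ≤ B * Y * Bᵀ := by
  rw [Matrix.le_iff] at *
  have := h.mul_mul_conjTranspose_same B
  rw [conjTranspose_eq_transpose_of_trivial] at this
  simpa [Matrix.mul_sub, Matrix.sub_mul] using this

theorem ric_smul_mono {n : ℕ} {X Y : Matrix (Fin n) (Fin n) ℝ} (h : X ≤ Y)
    {c : ℝ} (hc : 0 ≤ c) : c • X ≤ c • Y := by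
  rw [Matrix.le_iff] at *
  rw [← smul_sub]
  exact h.smul hc

theorem ric_smul_le {n : ℕ} {X : Matrix (Fin n) (Fin n) ℝ} (h : 0 ≤ X)
    {c d : ℝ} (hc : c ≤ d) : c • X ≤ d • X := by
  rw [Matrix.le_iff] at *
  rw [← sub_smul]
  rw [sub_zero] at h
  exact h.smul (sub_nonneg.2 hc)

/-- domination by a positive definite matrix -/
theorem ric_dom {n : ℕ} (D W : Matrix (Fin n) (Fin n) ℝ) (hD : D.PosDef)
    (hW : W.IsHermitian) : ∃ s : ℝ, 1 ≤ s ∧ W ≤ s • D := by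
  obtain ⟨B, hB⟩ := CStarAlgebra.nonneg_iff_eq_star_mul_self.1 hD.posSemidef.nonneg
  have hBu : IsUnit B.det := by
    have := hD.det_pos
    rw [hB, det_mul] at this
    exact isUnit_iff_ne_zero.2 (right_ne_zero_of_mul this.ne')
  have hBB : star B = Bᵀ := conjTranspose_eq_transpose_of_trivial B
  rw [hBB] at hB
  set V := (B⁻¹)ᵀ * W * B⁻¹ with hVd
  have hWt : Wᵀ = W := by rw [← conjTranspose_eq_transpose_of_trivial]; exact hW
  have hV : V.IsHermitian := by
    rw [IsHermitian, conjTranspose_eq_transpose_of_trivial]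
    simp [hVd, transpose_mul, hWt, Matrix.mul_assoc]
  refine ⟨max 1 (∑ i, ∑ j, |V i j|), le_max_left _ _, ?_⟩
  have h := ric_conj_mono (ric_le_sum V hV _ (le_max_right 1 _)) Bᵀ
  have e1 : Bᵀ * V * Bᵀᵀ = W := by
    rw [hVd, transpose_transpose, transpose_nonsing_inv]
    have : IsUnit Bᵀ.det := by rwa [det_transpose]
    calc Bᵀ * (Bᵀ⁻¹ * W * B⁻¹) * B = (Bᵀ * Bᵀ⁻¹) * W * (B⁻¹ * B) := by
          simp only [Matrix.mul_assoc]
      _ = W := by rw [mul_nonsing_inv _ this, nonsing_inv_mul _ hBu]; simp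
  rw [e1] at h
  simpa [hB] using h

theorem ric_contr {n : ℕ} (L : Matrix (Fin n) (Fin n) ℝ) (h : specRad Lᵀ < 1) :
    ∃ m : ℕ, (1 - L ^ m * (L ^ m)ᵀ).PosDef := by
  have h1 := ric_pow_tendsto _ h
  have hcont : Continuous (fun X : Matrix (Fin n) (Fin n) ℝ =>
      ∑ i, ∑ j, |(Xᵀ * X) i j|) := by
    refine continuous_finset_sum _ fun i _ => continuous_finset_sum _ fun j _ => ?_
    have : Continuous (fun X : Matrix (Fin n) (Fin n) ℝ => Xᵀ * X) := by fun_prop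
    exact (this.matrix_elem i j).abs
  have h2 := (hcont.tendsto 0).comp h1
  have h3 := (h2.eventually (gt_mem_nhds (show _ < (1/2 : ℝ) by simp))).exists
  obtain ⟨m, hm⟩ := h3
  refine ⟨m, ?_⟩
  simp only [Function.comp, ← transpose_pow, transpose_transpose] at hm
  have hH : (L ^ m * (L ^ m)ᵀ).IsHermitian := by
    rw [IsHermitian, conjTranspose_eq_transpose_of_trivial]; simp
  have h4 := ric_le_sum _ hH _ hm.le
  rw [Matrix.le_iff] at h4
  have h5 : (((1/2 : ℝ) • (1 : Matrix (Fin n) (Fin n) ℝ))).PosDef :=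
    PosDef.one.smul (by norm_num)
  have := h5.add_posSemidef h4
  convert this using 1
  rw [← add_sub_assoc, ← add_smul]; norm_num

theorem ric_lyap {n : ℕ} (L W : Matrix (Fin n) (Fin n) ℝ) (h : specRad Lᵀ < 1)
    (hW : W.IsHermitian) : ∃ Y, 0 ≤ Y ∧ L * Y * Lᵀ + W ≤ Y := by
  obtain ⟨m, hm⟩ := ric_contr L h
  obtain ⟨s, hs1, hs⟩ := ric_dom _ W hm hW
  set Z : Matrix (Fin n) (Fin n) ℝ := ∑ j ∈ Finset.range m, L ^ j * (L ^ j)ᵀ with hZ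
  have hZ0 : 0 ≤ Z := by
    refine Finset.sum_nonneg fun j _ => ?_
    rw [nonneg_iff_posSemidef, ← conjTranspose_eq_transpose_of_trivial]
    exact posSemidef_self_mul_conjTranspose _
  have hZL : L * Z * Lᵀ + 1 = Z + L ^ m * (L ^ m)ᵀ := by
    rw [hZ, ← Finset.sum_range_succ, Finset.sum_range_succ', Finset.mul_sum, Finset.sum_mul]
    congr 1
    · refine Finset.sum_congr rfl fun j _ => ?_
      rw [pow_succ', transpose_mul]; simp only [Matrix.mul_assoc]
    · simp
  refine ⟨s • Z, ?_, ?_⟩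
  · simpa using ric_smul_mono hZ0 (zero_le_one.trans hs1)
  · have : L * (s • Z) * Lᵀ = s • (Z + L ^ m * (L ^ m)ᵀ - 1) := by
      rw [← hZL]; simp
    rw [this]
    calc _ ≤ s • (Z + L ^ m * (L ^ m)ᵀ - 1) + s • (1 - L ^ m * (L ^ m)ᵀ) := by gcongr
      _ = s • Z := by rw [← smul_add]; congr 1; abel

/-- the Riccati map -/
noncomputable def ricR {n : ℕ} (A Q G P : Matrix (Fin n) (Fin n) ℝ) :
    Matrix (Fin n) (Fin n) ℝ :=
  A * P * Aᵀ - A * P * G * (1 + Gᵀ * P * G)⁻¹ * Gᵀ * P * Aᵀ + Q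

/-- the Riccati map with a fixed gain -/
noncomputable def ricF {n : ℕ} (A Q G K P : Matrix (Fin n) (Fin n) ℝ) :
    Matrix (Fin n) (Fin n) ℝ :=
  (A + K * Gᵀ) * P * (A + K * Gᵀ)ᵀ + K * Kᵀ + Q

theorem ric_symm {n : ℕ} {P : Matrix (Fin n) (Fin n) ℝ} (hP : 0 ≤ P) : Pᵀ = P := by
  rw [← conjTranspose_eq_transpose_of_trivial]; exact hP.posSemidef.isHermitian

theorem ric_S {n : ℕ} (G : Matrix (Fin n) (Fin n) ℝ) {P : Matrix (Fin n) (Fin n) ℝ}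
    (hP : 0 ≤ P) : (1 + Gᵀ * P * G).PosDef := by
  refine PosDef.one.add_posSemidef ?_
  rw [← conjTranspose_eq_transpose_of_trivial]
  exact hP.posSemidef.conjTranspose_mul_mul_same G

theorem ric_sq {n : ℕ} (A Q G K : Matrix (Fin n) (Fin n) ℝ) {P : Matrix (Fin n) (Fin n) ℝ}
    (hP : 0 ≤ P) :
    ricF A Q G K P = ricR A Q G P + (K + A * P * G * (1 + Gᵀ * P * G)⁻¹) * (1 + Gᵀ * P * G) *
      (K + A * P * G * (1 + Gᵀ * P * G)⁻¹)ᵀ := by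
  have hS := ric_S G hP
  have hu : IsUnit (1 + Gᵀ * P * G).det := hS.det_pos.ne'.isUnit
  have hPt := ric_symm hP
  have hTt := ric_symm (hS.inv.posSemidef.nonneg)
  have hTS := nonsing_inv_mul _ hu
  have hST := mul_nonsing_inv _ hu
  unfold ricF ricR
  generalize (1 + Gᵀ * P * G)⁻¹ = T at *
  simp only [transpose_add, transpose_mul, transpose_transpose, hPt, hTt]
  have e : (K + A * P * G * T) * (1 + Gᵀ * P * G) * (Kᵀ + T * (Gᵀ * (P * Aᵀ)))
     = K * (1 + Gᵀ * P * G) * Kᵀ + A * P * G * (T * (1 + Gᵀ * P * G)) * Kᵀ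
      + K * ((1 + Gᵀ * P * G) * T) * (Gᵀ * (P * Aᵀ))
      + A * P * G * (T * (1 + Gᵀ * P * G)) * T * (Gᵀ * (P * Aᵀ)) := by noncomm_ring
  rw [e, hTS, hST]
  noncomm_ring

theorem ricR_le {n : ℕ} (A Q G K : Matrix (Fin n) (Fin n) ℝ) {P : Matrix (Fin n) (Fin n) ℝ}
    (hP : 0 ≤ P) : ricR A Q G P ≤ ricF A Q G K P := by
  rw [ric_sq A Q G K hP]
  refine le_add_of_nonneg_right ?_
  have := ric_conj_mono (ric_S G hP).posSemidef.nonneg (K + A * P * G * (1 + Gᵀ * P * G)⁻¹)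
  simpa using this

theorem ricR_eq {n : ℕ} (A Q G : Matrix (Fin n) (Fin n) ℝ) {P : Matrix (Fin n) (Fin n) ℝ}
    (hP : 0 ≤ P) : ∃ K, ricR A Q G P = ricF A Q G K P := by
  refine ⟨-(A * P * G * (1 + Gᵀ * P * G)⁻¹), ?_⟩
  rw [ric_sq A Q G _ hP]
  simp

theorem ric_KK {n : ℕ} (K : Matrix (Fin n) (Fin n) ℝ) : 0 ≤ K * Kᵀ := by
  rw [nonneg_iff_posSemidef, ← conjTranspose_eq_transpose_of_trivial]
  exact posSemidef_self_mul_conjTranspose _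

theorem ricR_mono {n : ℕ} (A Q G : Matrix (Fin n) (Fin n) ℝ) {P P' : Matrix (Fin n) (Fin n) ℝ}
    (hP : 0 ≤ P) (h : P ≤ P') : ricR A Q G P ≤ ricR A Q G P' := by
  obtain ⟨K, hK⟩ := ricR_eq A Q G (hP.trans h)
  rw [hK]
  refine (ricR_le A Q G K hP).trans ?_
  unfold ricF
  have := ric_conj_mono h (A + K * Gᵀ)
  gcongr

theorem ricR_ge {n : ℕ} (A Q G : Matrix (Fin n) (Fin n) ℝ) {P : Matrix (Fin n) (Fin n) ℝ}
    (hP : 0 ≤ P) : Q ≤ ricR A Q G P := by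
  obtain ⟨K, hK⟩ := ricR_eq A Q G hP
  rw [hK]
  unfold ricF
  refine le_add_of_nonneg_left (add_nonneg ?_ (ric_KK K))
  simpa using ric_conj_mono hP (A + K * Gᵀ)

theorem ricR_scale {n : ℕ} (A Q G : Matrix (Fin n) (Fin n) ℝ) {P : Matrix (Fin n) (Fin n) ℝ}
    (hP : 0 ≤ P) {t : ℝ} (ht : 0 ≤ t) :
    ricR A Q G ((1 + t) • P) ≤ (1 + t) • ricR A Q G P - t • Q := by
  obtain ⟨K, hK⟩ := ricR_eq A Q G hP
  have h1 : 0 ≤ (1 + t) • P := by simpa using ric_smul_mono hP (show 0 ≤ 1 + t by linarith)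
  refine (ricR_le A Q G K h1).trans ?_
  rw [hK]
  have h2 : (1 + t) • ricF A Q G K P - t • Q = ricF A Q G K ((1 + t) • P) + t • (K * Kᵀ) := by
    unfold ricF
    simp only [Matrix.mul_smul, Matrix.smul_mul]
    module
  rw [h2]
  refine le_add_of_nonneg_right ?_
  simpa using ric_smul_mono (ric_KK K) ht

theorem ricR_cont {n : ℕ} (A Q G : Matrix (Fin n) (Fin n) ℝ) {P : Matrix (Fin n) (Fin n) ℝ}
    (hP : 0 ≤ P) : ContinuousAt (ricR A Q G) P := by
  have hd : (1 + Gᵀ * P * G).det ≠ 0 := (ric_S G hP).det_pos.ne'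
  have hi : ContinuousAt (fun P => (1 + Gᵀ * P * G)⁻¹) P := by
    simp only [Matrix.inv_def, Ring.inverse_eq_inv']
    have h1 : Continuous fun P : Matrix (Fin n) (Fin n) ℝ => 1 + Gᵀ * P * G := by fun_prop
    exact ContinuousAt.smul (ContinuousAt.inv₀ h1.matrix_det.continuousAt hd)
      h1.matrix_adjugate.continuousAt
  unfold ricR
  have h2 : ContinuousAt (fun P : Matrix (Fin n) (Fin n) ℝ => A * P * G) P := by fun_prop
  have h3 : ContinuousAt (fun P : Matrix (Fin n) (Fin n) ℝ => A * P * Aᵀ) P := by fun_prop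
  refine (h3.sub ?_).add continuousAt_const
  exact ((((h2.mul hi).mul continuousAt_const).mul continuousAt_id).mul continuousAt_const)

/-- quadratic form -/
noncomputable def ricq {n : ℕ} (X : Matrix (Fin n) (Fin n) ℝ) (x : Fin n → ℝ) : ℝ :=
  x ⬝ᵥ (X *ᵥ x)

theorem ricq_mono {n : ℕ} {X Y : Matrix (Fin n) (Fin n) ℝ} (h : X ≤ Y) (x : Fin n → ℝ) :
    ricq X x ≤ ricq Y x := by
  have := (Matrix.le_iff.1 h).dotProduct_mulVec_nonneg x
  rw [sub_mulVec, dotProduct_sub, sub_nonneg] at this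
  simpa [ricq] using this

theorem ricq_polar {n : ℕ} {X : Matrix (Fin n) (Fin n) ℝ} (h : Xᵀ = X) (i j : Fin n) :
    X i j = (ricq X (Pi.single i 1 + Pi.single j 1) - ricq X (Pi.single i 1)
      - ricq X (Pi.single j 1)) / 2 := by
  have : X j i = X i j := congrFun (congrFun h i) j
  simp [ricq, mulVec_add, this]
  ring

theorem ric_tendsto {n : ℕ} (X : ℕ → Matrix (Fin n) (Fin n) ℝ) (hX : ∀ k, (X k)ᵀ = X k)
    (q : (Fin n → ℝ) → ℝ) (h : ∀ x, Tendsto (fun k => ricq (X k) x) atTop (nhds (q x))) :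
    ∃ Y, Tendsto X atTop (nhds Y) := by
  refine ⟨Matrix.of fun i j => (q (Pi.single i 1 + Pi.single j 1) - q (Pi.single i 1)
      - q (Pi.single j 1)) / 2, ?_⟩
  refine tendsto_pi_nhds.2 fun i => tendsto_pi_nhds.2 fun j => ?_
  have := (((h (Pi.single i 1 + Pi.single j 1)).sub (h (Pi.single i 1))).sub
    (h (Pi.single j 1))).div_const 2
  refine this.congr fun k => ?_
  exact (ricq_polar (hX k) i j).symm

theorem ricq_cont {n : ℕ} (x : Fin n → ℝ) :
    Continuous (fun X : Matrix (Fin n) (Fin n) ℝ => ricq X x) := by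
  unfold ricq
  fun_prop

theorem ric_le_lim {n : ℕ} {X : ℕ → Matrix (Fin n) (Fin n) ℝ} {L Y : Matrix (Fin n) (Fin n) ℝ}
    (hX : ∀ k, Yᵀ = Y ∧ (X k)ᵀ = X k)
    (hL : Tendsto X atTop (nhds L)) (h : ∀ᶠ k in atTop, Y ≤ X k) : Y ≤ L := by
  have hLt : Lᵀ = L := by
    have h1 : Tendsto (fun k => (X k)ᵀ) atTop (nhds Lᵀ) :=
      ((continuous_id.matrix_transpose).tendsto L).comp hL
    simp only [fun k => (hX k).2] at h1
    exact tendsto_nhds_unique h1 hL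
  rw [Matrix.le_iff]
  refine PosSemidef.of_dotProduct_mulVec_nonneg ?_ fun x => ?_
  · rw [IsHermitian, conjTranspose_eq_transpose_of_trivial, transpose_sub, hLt, (hX 0).1]
  · rw [sub_mulVec, dotProduct_sub, sub_nonneg]
    have := ge_of_tendsto (((ricq_cont x).tendsto L).comp hL) (h.mono fun k hk => ricq_mono hk x)
    simpa [ricq] using this

theorem ric_squeeze {n : ℕ} {X Z W : ℕ → Matrix (Fin n) (Fin n) ℝ} {L : Matrix (Fin n) (Fin n) ℝ}
    (hX : ∀ k, (Z k)ᵀ = Z k) (hLt : Lᵀ = L)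
    (h1 : Tendsto X atTop (nhds L)) (h2 : Tendsto W atTop (nhds L))
    (h3 : ∀ k, X k ≤ Z k) (h4 : ∀ k, Z k ≤ W k) : Tendsto Z atTop (nhds L) := by
  have h : ∀ x, Tendsto (fun k => ricq (Z k) x) atTop (nhds (ricq L x)) := fun x =>
    tendsto_of_tendsto_of_tendsto_of_le_of_le (((ricq_cont x).tendsto L).comp h1)
      (((ricq_cont x).tendsto L).comp h2) (fun k => ricq_mono (h3 k) x)
      (fun k => ricq_mono (h4 k) x)
  refine tendsto_pi_nhds.2 fun i => tendsto_pi_nhds.2 fun j => ?_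
  have := (((h (Pi.single i 1 + Pi.single j 1)).sub (h (Pi.single i 1))).sub
    (h (Pi.single j 1))).div_const 2
  rw [← ricq_polar hLt] at this
  refine this.congr fun k => ?_
  exact (ricq_polar (hX k) i j).symm

theorem ric_main {n : ℕ} (A Q G : Matrix (Fin n) (Fin n) ℝ) (hQ : Q.PosDef)
    (hdet : Detectable A G) (hG : Gᵀ = G) :
    ∃ P, 0 ≤ P ∧ P = ricR A Q G P ∧
      ∀ P₀, 0 ≤ P₀ → Tendsto (fun k => (ricR A Q G)^[k] P₀) atTop (nhds P) := by
  have hQ0 : 0 ≤ Q := hQ.posSemidef.nonneg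
  have hpos : ∀ P₀, 0 ≤ P₀ → ∀ k, 0 ≤ (ricR A Q G)^[k] P₀ := by
    intro P₀ h0 k
    induction k with
    | zero => exact h0
    | succ k ih => rw [Function.iterate_succ_apply']; exact hQ0.trans (ricR_ge A Q G ih)
  have hmono : ∀ P₀ P₁, 0 ≤ P₀ → P₀ ≤ P₁ → ∀ k, (ricR A Q G)^[k] P₀ ≤ (ricR A Q G)^[k] P₁ := by
    intro P₀ P₁ h0 h1 k
    induction k with
    | zero => exact h1
    | succ k ih =>
      rw [Function.iterate_succ_apply', Function.iterate_succ_apply']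
      exact ricR_mono A Q G (hpos P₀ h0 k) ih
  obtain ⟨C, hC⟩ := hdet
  have hLt : Aᵀ + G * Cᵀ = (A + C * Gᵀ)ᵀ := by simp
  rw [hLt] at hC
  have hWH : (C * Cᵀ + Q).IsHermitian := (add_nonneg (ric_KK C) hQ0).posSemidef.isHermitian
  obtain ⟨Y, hY0, hY⟩ := ric_lyap _ _ hC hWH
  have hRY : ricR A Q G Y ≤ Y := by
    refine (ricR_le A Q G C hY0).trans ?_
    unfold ricF
    rwa [add_assoc]
  set X : ℕ → Matrix (Fin n) (Fin n) ℝ := fun k => (ricR A Q G)^[k] 0 with hXd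
  have hX0 : ∀ k, 0 ≤ X k := hpos 0 le_rfl
  have hXs : ∀ k, X (k + 1) = ricR A Q G (X k) := fun k => by
    simp only [hXd, Function.iterate_succ_apply']
  have hXY : ∀ k, X k ≤ Y := by
    intro k
    induction k with
    | zero => exact hY0
    | succ k ih => rw [hXs]; exact (ricR_mono A Q G (hX0 k) ih).trans hRY
  have hXm : Monotone X := by
    refine monotone_nat_of_le_succ fun k => ?_
    have := hmono 0 (ricR A Q G 0) le_rfl (hQ0.trans (ricR_ge A Q G le_rfl)) k
    rwa [← Function.iterate_succ_apply] at this
  obtain ⟨P, hP⟩ := ric_tendsto X (fun k => ric_symm (hX0 k)) (fun x => ⨆ k, ricq (X k) x)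
    (fun x => tendsto_atTop_ciSup (fun a b hab => ricq_mono (hXm hab) x)
      ⟨ricq Y x, by rintro _ ⟨k, rfl⟩; exact ricq_mono (hXY k) x⟩)
  have hP0 : 0 ≤ P := ric_le_lim (fun k => ⟨by simp, ric_symm (hX0 k)⟩) hP
    (Eventually.of_forall hX0)
  have hfix : P = ricR A Q G P := by
    have h1 := (ricR_cont A Q G hP0).tendsto.comp hP
    have h2 := hP.comp (tendsto_add_atTop_nat 1)
    have h3 : X ∘ (fun a => a + 1) = ricR A Q G ∘ X := funext hXs
    rw [h3] at h2
    exact tendsto_nhds_unique h2 h1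
  have hPQ : Q ≤ P := by rw [hfix]; exact ricR_ge A Q G hP0
  have hPD : P.PosDef := by
    have := hQ.add_posSemidef (Matrix.le_iff.1 hPQ)
    simpa using this
  refine ⟨P, hP0, hfix, fun P₀ hP₀ => ?_⟩
  obtain ⟨s, hs1, hs⟩ := ric_dom Q P hQ hP0.posSemidef.isHermitian
  obtain ⟨t, ht1, ht⟩ := ric_dom P P₀ hPD hP₀.posSemidef.isHermitian
  have hs0 : 0 < s := by linarith
  have hc1 : 0 ≤ 1 - s⁻¹ := by
    rw [sub_nonneg]; exact inv_le_one_of_one_le₀ hs1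
  have hc2 : 1 - s⁻¹ < 1 := by
    have : 0 < s⁻¹ := inv_pos.2 hs0
    linarith
  have hsQ : s⁻¹ • P ≤ Q := by
    have := ric_smul_mono hs (inv_nonneg.2 hs0.le)
    rwa [smul_smul, inv_mul_cancel₀ hs0.ne', one_smul] at this
  have hup : ∀ k, (ricR A Q G)^[k] P₀ ≤ (1 + t * (1 - s⁻¹) ^ k) • P := by
    intro k
    induction k with
    | zero => simpa using ht.trans (ric_smul_le hP0 (by linarith))
    | succ k ih =>
      rw [Function.iterate_succ_apply']
      set u := t * (1 - s⁻¹) ^ k with hu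
      have hu0 : 0 ≤ u := mul_nonneg (by linarith) (pow_nonneg hc1 k)
      refine (ricR_mono A Q G (hpos _ hP₀ k) ih).trans ((ricR_scale A Q G hP0 hu0).trans ?_)
      rw [← hfix]
      have h1 := ric_smul_mono hsQ hu0
      calc (1 + u) • P - u • Q ≤ (1 + u) • P - u • s⁻¹ • P := sub_le_sub_left h1 _
        _ = (1 + t * (1 - s⁻¹) ^ (k + 1)) • P := by
          rw [smul_smul, ← sub_smul, pow_succ, hu]; congr 1; ring
  refine ric_squeeze (fun k => ric_symm (hpos _ hP₀ k)) (ric_symm hP0) hP ?_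
    (fun k => hmono 0 P₀ le_rfl hP₀ k) hup
  have h1 := (((tendsto_pow_atTop_nhds_zero_of_lt_one hc1 hc2).const_mul t).const_add 1).smul_const P
  simpa using h1

/-- Convergence of the discrete-time Riccati recursion: if `Q` is symmetric positive
definite, `G` symmetric positive semi-definite, `(A, Q)` stabilizable and `(A, G)` detectable,
then for every symmetric positive semi-definite `P₀` the iterates of
`P ↦ APAᵀ − APG(I + GᵀPG)⁻¹GᵀPAᵀ + Q` converge to a limit `P∞` independent of `P₀`, and `P∞`
is the unique symmetric positive semi-definite solution of the corresponding discrete-time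
algebraic Riccati equation. -/
theorem riccati_recursion_converges
    {n : ℕ}
    (A Q G : Matrix (Fin n) (Fin n) ℝ)
    (hQ : Q.PosDef)
    (hG : G.PosSemidef)
    (hstab : Stabilizable A Q)
    (hdet : Detectable A G) :
    ∃ Pinf : Matrix (Fin n) (Fin n) ℝ,
      Pinf.PosSemidef ∧
      (Pinf = A * Pinf * Aᵀ
          - A * Pinf * G * (1 + Gᵀ * Pinf * G)⁻¹ * Gᵀ * Pinf * Aᵀ + Q) ∧
      (∀ P' : Matrix (Fin n) (Fin n) ℝ, P'.PosSemidef →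
        P' = A * P' * Aᵀ - A * P' * G * (1 + Gᵀ * P' * G)⁻¹ * Gᵀ * P' * Aᵀ + Q →
        P' = Pinf) ∧
      ∀ P₀ : Matrix (Fin n) (Fin n) ℝ, P₀.PosSemidef →
        Tendsto
          (fun k =>
            (fun P : Matrix (Fin n) (Fin n) ℝ =>
              A * P * Aᵀ - A * P * G * (1 + Gᵀ * P * G)⁻¹ * Gᵀ * P * Aᵀ + Q)^[k] P₀)
          atTop (nhds Pinf) := by
  have hGt : Gᵀ = G := ric_symm hG.nonneg
  obtain ⟨P, hP0, hfix, hconv⟩ := ric_main A Q G hQ hdet hGt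
  refine ⟨P, hP0.posSemidef, hfix, fun P' hP' h' => ?_, fun P₀ hP₀ => hconv P₀ hP₀.nonneg⟩
  have h1 := hconv P' hP'.nonneg
  have h2 : ∀ k, (ricR A Q G)^[k] P' = P' := fun k => Function.iterate_fixed h'.symm k
  simp only [h2] at h1
  exact tendsto_nhds_unique tendsto_const_nhds h1
end
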